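/- Let F : ℝ^{m+n} → ℝ≥0 be log-concave and Σ a positive definite quadratic form on ℝ^{m+n}. Writing w = (v, v') with v ∈ ℝ^m, v' ∈ ℝ^n, define G(v') = (∫_{ℝ^m} F(v,v')·exp(-Σ(v,v')) dv) / (∫_{ℝ^m} exp(-Σ(v,v')) dv). Then G is log-concave on ℝ^n. -/

import Mathlib

open MeasureTheory

open Set Pointwise ENNReal

/-- The one-dimensional Brunn-Minkowski inequality for compact sets. -/
lemma Real.volume_add_volume_le_volume_add {K L : Set ℝ} (hK : IsCompact K) (hL : IsCompact L)
    (hKn : K.Nonempty) (hLn : L.Nonempty) : volume K + volume L ≤ volume (K + L) := by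
  obtain ⟨p, hpK, hp⟩ := hK.exists_isGreatest hKn
  obtain ⟨q, hqL, hq⟩ := hL.exists_isLeast hLn
  have hdisj : AEDisjoint volume (K + {q}) ({p} + L) := by
    refine measure_mono_null (t := {p + q}) ?_ (by simp)
    rintro x ⟨⟨k, hk, _, rfl, rfl⟩, ⟨_, rfl, l, hl, hx⟩⟩
    have h1 := hp hk
    have h2 := hq hl
    simp only [mem_singleton_iff] at *
    linarith
  have hmeas : NullMeasurableSet ({p} + L) volume :=
    (isCompact_singleton.add hL).measurableSet.nullMeasurableSet
  calc volume K + volume L = volume (K + {q}) + volume ({p} + L) := by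
        simp [add_singleton, singleton_add, image_add_right, image_add_left]
    _ = volume ((K + {q}) ∪ ({p} + L)) := (measure_union₀ hmeas hdisj).symm
    _ ≤ volume (K + L) := measure_mono <| union_subset
        (add_subset_add_left (singleton_subset_iff.2 hqL))
        (add_subset_add_right (singleton_subset_iff.2 hpK))

lemma MeasurableSet.volume_le_of_forall_isCompact {A : Set ℝ} (hA : MeasurableSet A) {c : ℝ≥0∞}
    (h : ∀ K ⊆ A, IsCompact K → K.Nonempty → volume K ≤ c) : volume A ≤ c := by
  rw [hA.measure_eq_iSup_isCompact]
  refine iSup₂_le fun K hKA => iSup_le fun hK => ?_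
  rcases K.eq_empty_or_nonempty with rfl | hKn
  · simp
  · exact h K hKA hK hKn

/-- The one-dimensional Brunn-Minkowski inequality for convex combinations of measurable sets. -/
lemma Real.volume_convexCombo_le {A B C : Set ℝ} (hA : MeasurableSet A) (hB : MeasurableSet B)
    (hAn : A.Nonempty) (hBn : B.Nonempty) {t : ℝ} (ht0 : 0 < t) (ht1 : t < 1)
    (hC : ∀ x ∈ A, ∀ y ∈ B, t * x + (1 - t) * y ∈ C) :
    ENNReal.ofReal t * volume A + ENNReal.ofReal (1 - t) * volume B ≤ volume C := by
  have hs0 : 0 < 1 - t := by linarith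
  have hscale : ∀ {r : ℝ}, 0 < r → ∀ S : Set ℝ,
      volume (r • S) = ENNReal.ofReal r * volume S := fun {r} hr S => by
    rw [Measure.addHaar_smul]; simp [abs_of_pos hr]
  rw [← hscale ht0, ← hscale hs0]
  have hcompact : ∀ K ⊆ t • A, IsCompact K → K.Nonempty → ∀ L ⊆ (1 - t) • B, IsCompact L →
      L.Nonempty → volume K + volume L ≤ volume C := by
    intro K hKA hK hKn L hLB hL hLn
    refine (volume_add_volume_le_volume_add hK hL hKn hLn).trans (measure_mono ?_)
    rintro _ ⟨k, hk, l, hl, rfl⟩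
    obtain ⟨x, hx, rfl⟩ := hKA hk
    obtain ⟨y, hy, rfl⟩ := hLB hl
    exact hC x hx y hy
  have hleft : ∀ L ⊆ (1 - t) • B, IsCompact L → L.Nonempty →
      volume (t • A) + volume L ≤ volume C := by
    intro L hLB hL hLn
    have hLC : volume L ≤ volume C := by
      obtain ⟨a, ha⟩ := hAn
      exact le_add_self.trans (hcompact {t • a} (singleton_subset_iff.2 (smul_mem_smul_set ha))
        isCompact_singleton (singleton_nonempty _) L hLB hL hLn)
    have := (hA.const_smul_of_ne_zero ht0.ne').volume_le_of_forall_isCompact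
      (c := volume C - volume L) fun K hKA hK hKn =>
        ENNReal.le_sub_of_add_le_right hL.measure_lt_top.ne (hcompact K hKA hK hKn L hLB hL hLn)
    exact (add_le_add_left this _).trans (tsub_add_cancel_of_le hLC).le
  by_cases hAtop : volume (t • A) = ∞
  · obtain ⟨b, hb⟩ := hBn
    have := hleft {(1 - t) • b} (singleton_subset_iff.2 (smul_mem_smul_set hb))
      isCompact_singleton (singleton_nonempty _)
    rw [hAtop, top_add, top_le_iff] at this
    simp [this]
  have hAC : volume (t • A) ≤ volume C := by
    obtain ⟨b, hb⟩ := hBn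
    exact le_self_add.trans (hleft {(1 - t) • b} (singleton_subset_iff.2 (smul_mem_smul_set hb))
      isCompact_singleton (singleton_nonempty _))
  have := (hB.const_smul_of_ne_zero hs0.ne').volume_le_of_forall_isCompact
    (c := volume C - volume (t • A)) fun L hLB hL hLn =>
      ENNReal.le_sub_of_add_le_left hAtop (hleft L hLB hL hLn)
  exact (add_le_add_right this _).trans (add_tsub_cancel_of_le hAC).le

lemma ENNReal.rpow_mul_rpow_le_weighted_add (a b : ℝ≥0∞) {t : ℝ} (ht0 : 0 < t) (ht1 : t < 1) :
    a ^ t * b ^ (1 - t) ≤ ENNReal.ofReal t * a + ENNReal.ofReal (1 - t) * b := by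
  have hs0 : 0 < 1 - t := by linarith
  have hpq : (t⁻¹).HolderConjugate (1 - t)⁻¹ := by
    rw [Real.holderConjugate_iff]
    exact ⟨(one_lt_inv₀ ht0).2 ht1, by simp⟩
  have := ENNReal.young_inequality (a ^ t) (b ^ (1 - t)) hpq
  rwa [← ENNReal.rpow_mul, ← ENNReal.rpow_mul, mul_inv_cancel₀ ht0.ne', mul_inv_cancel₀ hs0.ne',
    ENNReal.rpow_one, ENNReal.rpow_one, ENNReal.ofReal_inv_of_pos ht0,
    ENNReal.ofReal_inv_of_pos hs0, div_eq_mul_inv, div_eq_mul_inv, inv_inv, inv_inv,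
    mul_comm a, mul_comm b] at this

lemma lintegral_eq_lintegral_meas_ofReal_lt {α : Type*} [MeasurableSpace α] {μ : Measure α}
    {f : α → ℝ≥0∞} (hf : Measurable f) (hfin : ∀ x, f x ≠ ∞) :
    ∫⁻ x, f x ∂μ = ∫⁻ s in Ioi (0 : ℝ), μ {x | ENNReal.ofReal s < f x} := by
  have := lintegral_eq_lintegral_meas_lt μ (f := fun x => (f x).toReal)
    (Filter.Eventually.of_forall fun x => ENNReal.toReal_nonneg) hf.ennreal_toReal.aemeasurable
  simp only [ENNReal.ofReal_toReal (hfin _)] at this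
  rw [this]
  refine setLIntegral_congr_fun measurableSet_Ioi fun s hs => ?_
  simp only [ENNReal.ofReal_lt_iff_lt_toReal (le_of_lt hs) (hfin _)]

lemma lintegral_convexCombo_le_of_iSup_eq_one {f g h : ℝ → ℝ≥0∞} (hf : Measurable f)
    (hg : Measurable g) (hh : Measurable h) (hf1 : ⨆ x, f x = 1) (hg1 : ⨆ x, g x = 1)
    {t : ℝ} (ht0 : 0 < t) (ht1 : t < 1)
    (hfgh : ∀ x y, f x ^ t * g y ^ (1 - t) ≤ h (t * x + (1 - t) * y)) :
    ENNReal.ofReal t * (∫⁻ x, f x) + ENNReal.ofReal (1 - t) * (∫⁻ x, g x) ≤ ∫⁻ x, h x := by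
  have hs0 : 0 < 1 - t := by linarith
  have hfle : ∀ x, f x ≤ 1 := fun x => hf1 ▸ le_iSup f x
  have hgle : ∀ x, g x ≤ 1 := fun x => hg1 ▸ le_iSup g x
  calc _ ≤ ∫⁻ x, min (h x) 1 := ?_
    _ ≤ ∫⁻ x, h x := lintegral_mono fun x => min_le_left _ _
  rw [lintegral_eq_lintegral_meas_ofReal_lt hf fun x => ((hfle x).trans_lt one_lt_top).ne,
    lintegral_eq_lintegral_meas_ofReal_lt hg fun x => ((hgle x).trans_lt one_lt_top).ne,
    lintegral_eq_lintegral_meas_ofReal_lt (hh.min measurable_const)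
      fun x => ((min_le_right _ _).trans_lt one_lt_top).ne]
  refine (add_le_add (lintegral_const_mul_le _ _) (lintegral_const_mul_le _ _)).trans
    ((le_lintegral_add _ _).trans (setLIntegral_mono' measurableSet_Ioi fun s hs => ?_))
  rcases lt_or_ge (ENNReal.ofReal s) 1 with hs1 | hs1
  · have hne : ∀ u : ℝ → ℝ≥0∞, ⨆ x, u x = 1 → {x | ENNReal.ofReal s < u x}.Nonempty :=
      fun u hu => lt_iSup_iff.1 (hs1.trans_eq hu.symm)
    refine Real.volume_convexCombo_le (measurableSet_lt measurable_const hf)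
      (measurableSet_lt measurable_const hg) (hne f hf1) (hne g hg1) ht0 ht1 fun x hx y hy => ?_
    refine lt_of_lt_of_le ?_ (le_min (hfgh x y) ?_)
    · have hpos : 0 < ENNReal.ofReal s := ENNReal.ofReal_pos.2 hs
      calc ENNReal.ofReal s = ENNReal.ofReal s ^ t * ENNReal.ofReal s ^ (1 - t) := by
            rw [← ENNReal.rpow_add _ _ hpos.ne' ofReal_ne_top]; simp
        _ < f x ^ t * g y ^ (1 - t) :=
            ENNReal.mul_lt_mul (ENNReal.rpow_lt_rpow hx ht0) (ENNReal.rpow_lt_rpow hy hs0)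
    · exact mul_le_one' (ENNReal.rpow_le_one (hfle x) ht0.le) (ENNReal.rpow_le_one (hgle y) hs0.le)
  · have hf0 : {x | ENNReal.ofReal s < f x} = ∅ :=
      eq_empty_of_forall_notMem fun x hx => ((hfle x).trans hs1).not_gt hx
    have hg0 : {x | ENNReal.ofReal s < g x} = ∅ :=
      eq_empty_of_forall_notMem fun x hx => ((hgle x).trans hs1).not_gt hx
    simp [hf0, hg0]

lemma prekopa_leindler_real_of_iSup_ne_top {f g h : ℝ → ℝ≥0∞} (hf : Measurable f)
    (hg : Measurable g) (hh : Measurable h) (hftop : ⨆ x, f x ≠ ∞) (hgtop : ⨆ x, g x ≠ ∞)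
    {t : ℝ} (ht0 : 0 < t) (ht1 : t < 1)
    (hfgh : ∀ x y, f x ^ t * g y ^ (1 - t) ≤ h (t * x + (1 - t) * y)) :
    (∫⁻ x, f x) ^ t * (∫⁻ x, g x) ^ (1 - t) ≤ ∫⁻ x, h x := by
  have hs0 : 0 < 1 - t := by linarith
  set M := ⨆ x, f x with hM
  set N := ⨆ x, g x with hN
  rcases eq_or_ne M 0 with hM0 | hM0
  · have : ∀ x, f x = 0 := by simpa [hM] using hM0
    simp [this, ht0]
  rcases eq_or_ne N 0 with hN0 | hN0
  · have : ∀ x, g x = 0 := by simpa [hN] using hN0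
    simp [this, hs0]
  have key := lintegral_convexCombo_le_of_iSup_eq_one (f := fun x => M⁻¹ * f x)
    (g := fun x => N⁻¹ * g x) (h := fun x => (M⁻¹ ^ t * N⁻¹ ^ (1 - t)) * h x)
    (hf.const_mul _) (hg.const_mul _) (hh.const_mul _)
    (by rw [← ENNReal.mul_iSup, ← hM, ENNReal.inv_mul_cancel hM0 hftop])
    (by rw [← ENNReal.mul_iSup, ← hN, ENNReal.inv_mul_cancel hN0 hgtop]) ht0 ht1 fun x y => by
      simp only [ENNReal.mul_rpow_of_nonneg _ _ ht0.le, ENNReal.mul_rpow_of_nonneg _ _ hs0.le]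
      rw [mul_mul_mul_comm]
      exact mul_le_mul_right (hfgh x y) _
  rw [lintegral_const_mul _ hf, lintegral_const_mul _ hg, lintegral_const_mul _ hh] at key
  have := (ENNReal.rpow_mul_rpow_le_weighted_add _ _ ht0 ht1).trans key
  rw [ENNReal.mul_rpow_of_nonneg _ _ ht0.le, ENNReal.mul_rpow_of_nonneg _ _ hs0.le,
    mul_mul_mul_comm] at this
  refine (ENNReal.mul_le_mul_iff_right ?_ ?_).1 this
  · exact mul_ne_zero (by simp [hM0, hftop]) (by simp [hN0, hgtop])
  · exact mul_ne_top (rpow_ne_top_of_nonneg ht0.le (by simpa))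
      (rpow_ne_top_of_nonneg hs0.le (by simpa))

lemma iSup_lintegral_min_natCast {f : ℝ → ℝ≥0∞} (hf : Measurable f) :
    ⨆ k : ℕ, ∫⁻ x, min (f x) k = ∫⁻ x, f x := by
  rw [← lintegral_iSup (fun k => hf.min measurable_const)]
  · refine lintegral_congr fun x => ?_
    rw [← inf_iSup_eq, ENNReal.iSup_natCast, inf_top_eq]
  · exact fun i j hij x => min_le_min_left _ (by exact_mod_cast hij)

/-- The Prékopa-Leindler inequality holds with respect to `μ`. -/
def PrekopaLeindler {E : Type*} [AddCommGroup E] [Module ℝ E] [MeasurableSpace E]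
    (μ : Measure E) : Prop :=
  ∀ ⦃f g h : E → ℝ≥0∞⦄, Measurable f → Measurable g → Measurable h →
    ∀ ⦃t : ℝ⦄, 0 < t → t < 1 →
    (∀ x y, f x ^ t * g y ^ (1 - t) ≤ h (t • x + (1 - t) • y)) →
    (∫⁻ x, f x ∂μ) ^ t * (∫⁻ x, g x ∂μ) ^ (1 - t) ≤ ∫⁻ x, h x ∂μ

lemma PrekopaLeindler.real : PrekopaLeindler (volume : Measure ℝ) := by
  intro f g h hf hg hh t ht0 ht1 hfgh
  have hs0 : 0 < 1 - t := by linarith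
  have hsup : ∀ {r : ℝ}, 0 < r → ∀ u : ℕ → ℝ≥0∞, (⨆ k, u k) ^ r = ⨆ k, u k ^ r :=
    fun {r} hr u => (ENNReal.orderIsoRpow r hr).map_iSup u
  rw [← iSup_lintegral_min_natCast hf, ← iSup_lintegral_min_natCast hg, hsup ht0, hsup hs0,
    ENNReal.iSup_mul]
  refine iSup_le fun k => ?_
  rw [ENNReal.mul_iSup]
  refine iSup_le fun l => ?_
  have hbdd : ∀ (u : ℝ → ℝ≥0∞) (k : ℕ), ⨆ x, min (u x) k ≠ ∞ := fun u k =>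
    ((iSup_le fun x => min_le_right _ _).trans_lt (natCast_lt_top k)).ne
  refine prekopa_leindler_real_of_iSup_ne_top (hf.min measurable_const) (hg.min measurable_const)
    hh (hbdd f k) (hbdd g l) ht0 ht1 fun x y => le_trans ?_ (hfgh x y)
  gcongr <;> exact min_le_left _ _

lemma PrekopaLeindler.prod {E F : Type*} [AddCommGroup E] [Module ℝ E] [MeasurableSpace E]
    [AddCommGroup F] [Module ℝ F] [MeasurableSpace F] {μ : Measure E} {ν : Measure F}
    [SFinite ν] (hμ : PrekopaLeindler μ) (hν : PrekopaLeindler ν) :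
    PrekopaLeindler (μ.prod ν) := by
  intro f g h hf hg hh t ht0 ht1 hfgh
  rw [lintegral_prod _ hf.aemeasurable, lintegral_prod _ hg.aemeasurable,
    lintegral_prod _ hh.aemeasurable]
  refine hμ hf.lintegral_prod_right' hg.lintegral_prod_right' hh.lintegral_prod_right' ht0 ht1
    fun x y => ?_
  exact hν (hf.comp measurable_prodMk_left) (hg.comp measurable_prodMk_left)
    (hh.comp measurable_prodMk_left) ht0 ht1 fun x' y' => hfgh (x, x') (y, y')

lemma PrekopaLeindler.of_measurePreserving {E F : Type*} [AddCommGroup E] [Module ℝ E]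
    [MeasurableSpace E] [AddCommGroup F] [Module ℝ F] [MeasurableSpace F] {μ : Measure E}
    {ν : Measure F} (hμ : PrekopaLeindler μ) {φ : E → F} (hφ : MeasurePreserving φ μ ν)
    (hlin : IsLinearMap ℝ φ) : PrekopaLeindler ν := by
  intro f g h hf hg hh t ht0 ht1 hfgh
  rw [← hφ.lintegral_comp hf, ← hφ.lintegral_comp hg, ← hφ.lintegral_comp hh]
  refine hμ (hf.comp hφ.measurable) (hg.comp hφ.measurable) (hh.comp hφ.measurable) ht0 ht1
    fun x y => ?_
  simpa only [Function.comp, hlin.map_add, hlin.map_smul] using hfgh (φ x) (φ y)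

/-- The **Prékopa-Leindler inequality** on `ℝ^m`. -/
theorem PrekopaLeindler.pi : ∀ m : ℕ, PrekopaLeindler (volume : Measure (Fin m → ℝ))
  | 0 => by
    intro f g h _ _ _ t _ _ hfgh
    have hvol : (volume : Measure (Fin 0 → ℝ)) = Measure.dirac default :=
      Measure.volume_pi_eq_dirac _
    simp only [hvol, lintegral_dirac]
    exact (hfgh default default).trans_eq (congrArg h (Subsingleton.elim _ _))
  | m + 1 => by
    refine (PrekopaLeindler.real.prod (PrekopaLeindler.pi m)).of_measurePreserving
      (volume_preserving_piFinSuccAbove (fun _ : Fin (m + 1) => ℝ) 0).symm ⟨?_, ?_⟩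
    · intro x y
      ext i
      refine Fin.cases ?_ (fun j => ?_) i <;> simp [MeasurableEquiv.piFinSuccAbove]
    · intro c x
      ext i
      refine Fin.cases ?_ (fun j => ?_) i <;> simp [MeasurableEquiv.piFinSuccAbove]

/-- The fibre over `b` has a point that is orthogonal to the first factor. -/
lemma QuadraticMap.PosDef.exists_polar_fst_eq_zero {V W : Type*} [AddCommGroup V] [Module ℝ V]
    [FiniteDimensional ℝ V] [AddCommGroup W] [Module ℝ W] {Q : QuadraticForm ℝ (V × W)}
    (hQ : Q.PosDef) (b : W) : ∃ l : V, ∀ v : V, polar Q (v, 0) (l, b) = 0 := by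
  let i := LinearMap.inl ℝ V W
  let T : V →ₗ[ℝ] Module.Dual ℝ V := Q.polarBilin.compl₁₂ i i
  have hT : Function.Injective T := by
    rw [← LinearMap.ker_eq_bot, LinearMap.ker_eq_bot']
    intro v hv
    by_contra hne
    have h1 : polar Q (v, 0) (v, 0) = 0 := LinearMap.congr_fun hv v
    have h2 := hQ (v, 0) (by simpa using hne)
    rw [polar_self, smul_eq_zero] at h1
    simp [h2.ne'] at h1
  obtain ⟨l, hl⟩ := (LinearMap.injective_iff_surjective_of_finrank_eq_finrank
    Subspace.dual_finrank_eq.symm).1 hT (-(Q.polarBilin (0, b) ∘ₗ i))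
  refine ⟨l, fun v => ?_⟩
  have h1 : polar Q (l, 0) (v, 0) = -polar Q (0, b) (v, 0) := LinearMap.congr_fun hl v
  have h2 : ((l, b) : V × W) = (l, 0) + (0, b) := by simp
  rw [h2, polar_comm, polar_add_left, h1, neg_add_cancel]

lemma QuadraticMap.map_prodMk_of_polar_eq_zero {V W : Type*} [AddCommGroup V] [Module ℝ V]
    [AddCommGroup W] [Module ℝ W] (Q : QuadraticForm ℝ (V × W)) {l : V} {b : W}
    (hl : ∀ v : V, polar Q (v, 0) (l, b) = 0) (v : V) :
    Q (v, b) = Q (v - l, 0) + Q (l, b) := by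
  have h : ((v, b) : V × W) = (v - l, 0) + (l, b) := by simp
  rw [h, QuadraticMap.map_add Q, hl, add_zero]

lemma QuadraticMap.continuous_of_finiteDimensional {V : Type*} [NormedAddCommGroup V]
    [NormedSpace ℝ V] [FiniteDimensional ℝ V] (Q : QuadraticForm ℝ V) : Continuous Q := by
  have h : ∀ v, Q v = 2⁻¹ * Q.polarBilin.toContinuousBilinearMap v v := fun v => by
    have := polar_self Q v
    simp_all
  rw [show (Q : V → ℝ) = _ from funext h]
  fun_prop

lemma QuadraticMap.PosDef.map_convexCombo_le {V : Type*} [AddCommGroup V] [Module ℝ V]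
    {Q : QuadraticForm ℝ V} (hQ : Q.PosDef) (x y : V) {t : ℝ} (ht0 : 0 ≤ t) (ht1 : t ≤ 1) :
    Q (t • x + (1 - t) • y) ≤ t * Q x + (1 - t) * Q y := by
  have h0 := hQ.nonneg (x - y)
  rw [sub_eq_add_neg, QuadraticMap.map_add Q, QuadraticMap.map_neg, polar_neg_right] at h0
  rw [QuadraticMap.map_add Q, QuadraticMap.map_smul, QuadraticMap.map_smul, polar_smul_left,
    polar_smul_right]
  simp only [smul_eq_mul]
  nlinarith [mul_nonneg (mul_nonneg ht0 (sub_nonneg.2 ht1)) h0]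

/-- Integrating against a Gaussian fibre and normalizing amounts to recentring the Gaussian. -/
lemma QuadraticMap.integral_div_integral_exp_neg {m : ℕ} {W : Type*} [AddCommGroup W]
    [Module ℝ W] (Q : QuadraticForm ℝ ((Fin m → ℝ) × W)) {l : Fin m → ℝ} {b : W}
    (hl : ∀ v, polar Q (v, 0) (l, b) = 0) (u : (Fin m → ℝ) → ℝ) :
    (∫ v, u v * Real.exp (-Q (v, b))) / (∫ v, Real.exp (-Q (v, b))) =
      (∫ v, u v * Real.exp (-Q (v - l, 0))) / ∫ v, Real.exp (-Q (v, 0)) := by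
  have hexp : ∀ v, Real.exp (-Q (v, b)) = Real.exp (-Q (v - l, 0)) * Real.exp (-Q (l, b)) :=
    fun v => by rw [Q.map_prodMk_of_polar_eq_zero hl, neg_add, Real.exp_add]
  have hnum : ∀ v, u v * Real.exp (-Q (v, b)) =
      u v * Real.exp (-Q (v - l, 0)) * Real.exp (-Q (l, b)) := fun v => by rw [hexp, mul_assoc]
  rw [integral_congr_ae (.of_forall hnum), integral_congr_ae (.of_forall hexp),
    integral_mul_const, integral_mul_const,
    integral_sub_right_eq_self (fun v => Real.exp (-Q (v, 0))) l,
    mul_div_mul_right _ _ (Real.exp_ne_zero _)]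

/-- The Prékopa-Leindler inequality for integrable real functions. -/
lemma PrekopaLeindler.integral_le {E : Type*} [AddCommGroup E] [Module ℝ E] [MeasurableSpace E]
    {μ : Measure E} (hμ : PrekopaLeindler μ) {f g h : E → ℝ} (hf : Measurable f)
    (hg : Measurable g) (hh : Measurable h) (hf0 : 0 ≤ f) (hg0 : 0 ≤ g) (hh0 : 0 ≤ h)
    (hfi : Integrable f μ) (hgi : Integrable g μ) (hhi : Integrable h μ)
    {t : ℝ} (ht0 : 0 < t) (ht1 : t < 1)
    (hfgh : ∀ x y, f x ^ t * g y ^ (1 - t) ≤ h (t • x + (1 - t) • y)) :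
    (∫ x, f x ∂μ) ^ t * (∫ x, g x ∂μ) ^ (1 - t) ≤ ∫ x, h x ∂μ := by
  have hs0 : 0 < 1 - t := by linarith
  have hofReal : ∀ {a b : ℝ}, 0 ≤ a → 0 ≤ b →
      ENNReal.ofReal (a ^ t * b ^ (1 - t)) =
        ENNReal.ofReal a ^ t * ENNReal.ofReal b ^ (1 - t) := fun {a b} ha hb => by
    rw [ENNReal.ofReal_mul (by positivity), ENNReal.ofReal_rpow_of_nonneg ha ht0.le,
      ENNReal.ofReal_rpow_of_nonneg hb hs0.le]
  rw [← ENNReal.ofReal_le_ofReal_iff (integral_nonneg hh0),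
    hofReal (integral_nonneg hf0) (integral_nonneg hg0),
    ofReal_integral_eq_lintegral_ofReal hfi (.of_forall hf0),
    ofReal_integral_eq_lintegral_ofReal hgi (.of_forall hg0),
    ofReal_integral_eq_lintegral_ofReal hhi (.of_forall hh0)]
  refine hμ hf.ennreal_ofReal hg.ennreal_ofReal hh.ennreal_ofReal ht0 ht1 fun x y => ?_
  rw [← hofReal (hf0 x) (hg0 y)]
  exact ENNReal.ofReal_le_ofReal (hfgh x y)

theorem stmt_19 (m n : ℕ) (F : (Fin m → ℝ) × (Fin n → ℝ) → ℝ)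
    (hFnn : ∀ w, 0 ≤ F w)
    (hFlc : ∀ w₁ w₂ : (Fin m → ℝ) × (Fin n → ℝ), ∀ t : ℝ, 0 ≤ t → t ≤ 1 →
      F w₁ ^ t * F w₂ ^ (1 - t) ≤ F (t • w₁ + (1 - t) • w₂))
    (Q : QuadraticForm ℝ ((Fin m → ℝ) × (Fin n → ℝ))) (hQ : Q.PosDef)
    (hFmeas : Measurable F)
    (hint : ∀ v' : Fin n → ℝ,
      Integrable (fun v : Fin m → ℝ => F (v, v') * Real.exp (-Q (v, v'))))
    (G : (Fin n → ℝ) → ℝ)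
    (hG : ∀ v', G v' = (∫ v : Fin m → ℝ, F (v, v') * Real.exp (-Q (v, v'))) /
      (∫ v : Fin m → ℝ, Real.exp (-Q (v, v')))) :
    ∀ a b : Fin n → ℝ, ∀ t : ℝ, 0 ≤ t → t ≤ 1 →
      G a ^ t * G b ^ (1 - t) ≤ G (t • a + (1 - t) • b) := by
  intro a b t ht0 ht1
  rcases ht0.eq_or_lt with rfl | ht0'
  · simp
  rcases ht1.eq_or_lt with rfl | ht1'
  · simp
  have hs0 : 0 < 1 - t := by linarith
  obtain ⟨p, hp⟩ := hQ.exists_polar_fst_eq_zero a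
  obtain ⟨q, hq⟩ := hQ.exists_polar_fst_eq_zero b
  have hr : ∀ v, QuadraticMap.polar Q (v, 0) (t • p + (1 - t) • q, t • a + (1 - t) • b) = 0 := by
    intro v
    have : ((t • p + (1 - t) • q, t • a + (1 - t) • b) : (Fin m → ℝ) × (Fin n → ℝ)) =
        t • (p, a) + (1 - t) • (q, b) := by simp
    rw [this, QuadraticMap.polar_add_right, QuadraticMap.polar_smul_right,
      QuadraticMap.polar_smul_right, hp, hq]
    simp
  have hQcont : Continuous fun v : Fin m → ℝ => Q (v, 0) :=
    Q.continuous_of_finiteDimensional.comp (by fun_prop)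
  have hmeas : ∀ l c, Measurable fun v : Fin m → ℝ => F (v, c) * Real.exp (-Q (v - l, 0)) :=
    fun l c => (hFmeas.comp measurable_prodMk_right).mul
      (Real.continuous_exp.comp (hQcont.comp (continuous_id.sub continuous_const)).neg).measurable
  have hnonneg : ∀ l c, 0 ≤ fun v : Fin m → ℝ => F (v, c) * Real.exp (-Q (v - l, 0)) :=
    fun l c v => mul_nonneg (hFnn _) (Real.exp_nonneg _)
  have hintegrable : ∀ l c, (∀ v, QuadraticMap.polar Q (v, 0) (l, c) = 0) →
      Integrable fun v : Fin m → ℝ => F (v, c) * Real.exp (-Q (v - l, 0)) := by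
    intro l c hl
    refine ((hint c).mul_const (Real.exp (Q (l, c)))).congr (.of_forall fun v => ?_)
    simp only
    rw [mul_assoc, ← Real.exp_add, Q.map_prodMk_of_polar_eq_zero hl]
    ring_nf
  have key := (PrekopaLeindler.pi m).integral_le (hmeas p a) (hmeas q b) (hmeas _ _)
    (hnonneg p a) (hnonneg q b) (hnonneg _ _) (hintegrable p a hp) (hintegrable q b hq)
    (hintegrable _ _ hr) ht0' ht1' fun x y => by
      rw [Real.mul_rpow (hFnn _) (Real.exp_nonneg _), Real.mul_rpow (hFnn _) (Real.exp_nonneg _),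
        mul_mul_mul_comm, ← Real.exp_mul, ← Real.exp_mul, ← Real.exp_add]
      refine mul_le_mul (hFlc (x, a) (y, b) t ht0 ht1) (Real.exp_le_exp.2 ?_)
        (Real.exp_nonneg _) (hFnn _)
      have hcomb : ((t • x + (1 - t) • y - (t • p + (1 - t) • q), 0) :
          (Fin m → ℝ) × (Fin n → ℝ)) = t • (x - p, 0) + (1 - t) • (y - q, 0) := by
        ext i
        · simp; ring
        · simp
      rw [hcomb]
      linarith [hQ.map_convexCombo_le (x - p, 0) (y - q, 0) ht0 ht1]
  have hZ : 0 ≤ ∫ v : Fin m → ℝ, Real.exp (-Q (v, 0)) :=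
    integral_nonneg fun v => Real.exp_nonneg _
  rw [hG, hG, hG, Q.integral_div_integral_exp_neg hp, Q.integral_div_integral_exp_neg hq,
    Q.integral_div_integral_exp_neg hr]
  rw [Real.div_rpow (integral_nonneg (hnonneg p a)) hZ,
    Real.div_rpow (integral_nonneg (hnonneg q b)) hZ, div_mul_div_comm,
    ← Real.rpow_add_of_nonneg hZ ht0 hs0.le, add_sub_cancel, Real.rpow_one]
  exact div_le_div_of_nonneg_right key hZ
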